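/- Let 0 < ε ≤ 1/8. Then the frontier of U₀ in S⁵ equals the union of the frontiers of U₁ and U₂ in S⁵: ∂U₀ = ∂U₁ ∪ ∂U₂. -/

import Mathlib

open Matrix

noncomputable section

/-- `ξ = exp(2πi/3)`, a primitive cube root of unity. -/
def ξ : ℂ := Complex.exp (2 * Real.pi * Complex.I / 3)

/-- The cyclic permutation matrix `A`, with rows `(0,1,0)`, `(0,0,1)`, `(1,0,0)`. -/
def A : Matrix (Fin 3) (Fin 3) ℂ := !![0, 1, 0; 0, 0, 1; 1, 0, 0]

/-- The diagonal matrix `B = diag(1, ξ, ξ²)`. -/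
def B : Matrix (Fin 3) (Fin 3) ℂ := !![1, 0, 0; 0, ξ, 0; 0, 0, ξ ^ 2]

/-- The matrix `P = (1/√3)·[[1,ξ,1],[1,1,ξ],[ξ,1,1]]`. -/
def P : Matrix (Fin 3) (Fin 3) ℂ :=
  (((Real.sqrt 3 : ℝ) : ℂ))⁻¹ • !![1, ξ, 1; 1, 1, ξ; ξ, 1, 1]

/-- Euclidean space `ℂ³`. -/
abbrev E3 := EuclideanSpace ℂ (Fin 3)

/-- Application of a `3 × 3` complex matrix to a vector in `ℂ³`. -/
def app (M : Matrix (Fin 3) (Fin 3) ℂ) (v : E3) : E3 := Matrix.toEuclideanLin M v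

/-- The unit sphere `S⁵ ⊆ ℂ³`. -/
abbrev S5 : Set E3 := Metric.sphere (0 : E3) 1

/-- The subset `U₁ = {A^k v : k ∈ ℕ, ‖v‖ = 1, |v₂|² + |v₃|² ≤ ε}` of `S⁵`. -/
def U1 (ε : ℝ) : Set S5 :=
  {w | ∃ (k : ℕ) (v : E3), ‖v‖ = 1 ∧ ‖v 1‖ ^ 2 + ‖v 2‖ ^ 2 ≤ ε ∧ (w : E3) = app (A ^ k) v}

/-- The subset `U₂ = P · U₁` of `S⁵`. -/
def U2 (ε : ℝ) : Set S5 := {w | ∃ u ∈ U1 ε, (w : E3) = app P (u : E3)}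

/-- The subset `U₀`: the closure, in `S⁵`, of the complement `S⁵ \ (U₁ ∪ U₂)`. -/
def U0 (ε : ℝ) : Set S5 := closure ((U1 ε ∪ U2 ε)ᶜ)

section Topology

variable {X : Type*} [TopologicalSpace X]

lemma IsClosed.frontier_closure_compl {V : Set X} (hV : IsClosed V)
    (hreg : V ⊆ closure (interior V)) : frontier (closure Vᶜ) = frontier V := by
  have h : closure (interior V) = V :=
    (closure_minimal interior_subset hV).antisymm hreg
  rw [closure_compl, frontier_compl, frontier, h, interior_interior, hV.frontier_eq]

lemma IsClosed.frontier_subset_frontier_union {s t : Set X} (hs : IsClosed s) (ht : IsClosed t)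
    (hd : Disjoint s t) : frontier s ⊆ frontier (s ∪ t) := by
  intro x hx
  rw [hs.frontier_eq] at hx
  rw [(hs.union ht).frontier_eq]
  refine ⟨Or.inl hx.1, fun hi => hx.2 ?_⟩
  have hsub : interior (s ∪ t) ∩ tᶜ ⊆ s := fun y hy =>
    (interior_subset hy.1).resolve_right hy.2
  exact interior_maximal hsub (isOpen_interior.inter ht.isOpen_compl)
    ⟨hi, Set.disjoint_left.mp hd hx.1⟩

lemma IsClosed.frontier_union_of_disjoint {s t : Set X} (hs : IsClosed s) (ht : IsClosed t)
    (hd : Disjoint s t) : frontier (s ∪ t) = frontier s ∪ frontier t := by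
  apply Set.Subset.antisymm
  · exact (frontier_union_subset s t).trans
      (Set.union_subset_union Set.inter_subset_left Set.inter_subset_right)
  · refine Set.union_subset (hs.frontier_subset_frontier_union ht hd) ?_
    rw [Set.union_comm]
    exact ht.frontier_subset_frontier_union hs hd.symm

end Topology

/-- The closed tube `{w ∈ S⁵ : r ≤ |⟨e, w⟩|²}` around the circle spanned by `e`. -/
def tube (r : ℝ) (e : E3) : Set S5 := {w | r ≤ ‖inner ℂ e (w : E3)‖ ^ 2}

lemma isClosed_tube (r : ℝ) (e : E3) : IsClosed (tube r e) :=
  isClosed_le continuous_const (by fun_prop)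

lemma lt_inner_sq_normalize {e w : E3} (he : ‖e‖ = 1) (hw : ‖w‖ = 1)
    (h0 : 0 < ‖inner ℂ e w‖ ^ 2) (h1 : ‖inner ℂ e w‖ ^ 2 < 1) {t : ℝ} (ht : 0 < t) :
    w + ((t : ℂ) * inner ℂ e w) • e ≠ 0 ∧
    ‖inner ℂ e w‖ ^ 2 < ‖inner ℂ e
      (((‖w + ((t : ℂ) * inner ℂ e w) • e‖⁻¹ : ℝ) : ℂ) • (w + ((t : ℂ) * inner ℂ e w) • e))‖ ^ 2 := by
  set c := inner ℂ e w with hc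
  set x := w + ((t : ℂ) * c) • e with hx
  have hee : inner ℂ e e = (1 : ℂ) := by
    rw [inner_self_eq_norm_sq_to_K, he]; simp
  have hin : inner ℂ e x = ((1 + t : ℝ) : ℂ) * c := by
    rw [hx, inner_add_right, inner_smul_right, hee, ← hc]; push_cast; ring
  have hinn : ‖inner ℂ e x‖ ^ 2 = (1 + t) ^ 2 * ‖c‖ ^ 2 := by
    rw [hin, norm_mul, Complex.norm_real, mul_pow, Real.norm_eq_abs, sq_abs]
  have hnorm : ‖x‖ ^ 2 = 1 + (2 * t + t ^ 2) * ‖c‖ ^ 2 := by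
    have hre : RCLike.re (inner ℂ w (((t : ℂ) * c) • e)) = t * ‖c‖ ^ 2 := by
      rw [inner_smul_right, ← inner_conj_symm w e, ← hc, mul_assoc, RCLike.mul_conj]
      have : (t : ℂ) * ((‖c‖ : ℂ) ^ 2) = ((t * ‖c‖ ^ 2 : ℝ) : ℂ) := by push_cast; rfl
      exact (congrArg Complex.re this).trans (Complex.ofReal_re _)
    rw [hx, norm_add_sq (𝕜 := ℂ), hre, hw, norm_smul, he, norm_mul, Complex.norm_real,
      Real.norm_eq_abs, mul_one, mul_pow, sq_abs]
    ring
  have hpos : 0 < ‖x‖ ^ 2 := by rw [hnorm]; positivity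
  refine ⟨fun h => by simp [h] at hpos, ?_⟩
  rw [inner_smul_right, norm_mul, mul_pow, hinn, Complex.norm_real, Real.norm_eq_abs, sq_abs,
    inv_pow, inv_mul_eq_div, lt_div_iff₀ hpos, hnorm]
  nlinarith [mul_pos (mul_pos ht (by linarith : 0 < 2 + t)) (mul_pos h0 (sub_pos.mpr h1))]

lemma tube_subset_closure_interior {r : ℝ} (h0 : 0 < r) (h1 : r < 1) {e : E3} (he : ‖e‖ = 1) :
    tube r e ⊆ closure (interior (tube r e)) := by
  have hopen : {w : S5 | r < ‖inner ℂ e (w : E3)‖ ^ 2} ⊆ interior (tube r e) :=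
    interior_maximal (fun _ (hw : r < _) => hw.le) (isOpen_lt continuous_const (by fun_prop))
  refine subset_trans ?_ (closure_mono hopen)
  intro w hw
  rcases (show r ≤ ‖inner ℂ e (w : E3)‖ ^ 2 from hw).lt_or_eq with hlt | heq
  · exact subset_closure hlt
  have hwn : ‖(w : E3)‖ = 1 := by simp
  have key := fun {t : ℝ} (ht : 0 < t) =>
    lt_inner_sq_normalize he hwn (heq ▸ h0) (heq ▸ h1) ht
  let x : ℝ → E3 := fun t => (w : E3) + ((t : ℂ) * inner ℂ e (w : E3)) • e
  have hx0 : x 0 = w := by simp [x]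
  have hxc : Continuous x := by fun_prop
  have htend : Filter.Tendsto (fun t => ((‖x t‖⁻¹ : ℝ) : ℂ) • x t) (nhdsWithin 0 (Set.Ioi 0))
      (nhds (w : E3)) := by
    have hc : ContinuousAt (fun t => ((‖x t‖⁻¹ : ℝ) : ℂ) • x t) 0 := by
      refine ContinuousAt.smul (Complex.continuous_ofReal.continuousAt.comp
        (hxc.norm.continuousAt.inv₀ ?_)) hxc.continuousAt
      rw [hx0, hwn]; exact one_ne_zero
    have := hc.tendsto
    simp only [hx0, hwn, inv_one, Complex.ofReal_one, one_smul] at this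
    exact this.mono_left nhdsWithin_le_nhds
  rw [closure_subtype]
  refine mem_closure_of_tendsto htend ?_
  filter_upwards [self_mem_nhdsWithin] with t ht
  obtain ⟨hne, hlt⟩ := key ht
  refine ⟨⟨((‖x t‖⁻¹ : ℝ) : ℂ) • x t, ?_⟩, ?_, rfl⟩
  · rw [mem_sphere_zero_iff_norm, norm_smul, Complex.norm_real, norm_inv, norm_norm]
    exact inv_mul_cancel₀ (norm_ne_zero_iff.mpr hne)
  · exact heq.trans_lt hlt

lemma app_mul (M N : Matrix (Fin 3) (Fin 3) ℂ) (v : E3) : app (M * N) v = app M (app N v) := by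
  ext i; simp [app, Matrix.toLpLin_apply]

lemma app_one (v : E3) : app 1 v = v := by
  simp [app]

lemma inner_app_right (M : Matrix (Fin 3) (Fin 3) ℂ) (v w : E3) :
    inner ℂ v (app M w) = inner ℂ (app Mᴴ v) w := by
  rw [app, app, Matrix.toEuclideanLin_conjTranspose_eq_adjoint, LinearMap.adjoint_inner_left]

lemma inner_app_app {M : Matrix (Fin 3) (Fin 3) ℂ} (hM : Mᴴ * M = 1) (v w : E3) :
    inner ℂ (app M v) (app M w) = inner ℂ v w := by
  rw [inner_app_right, ← app_mul, hM, app_one]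

lemma norm_app {M : Matrix (Fin 3) (Fin 3) ℂ} (hM : Mᴴ * M = 1) (v : E3) : ‖app M v‖ = ‖v‖ := by
  rw [@norm_eq_sqrt_re_inner ℂ, @norm_eq_sqrt_re_inner ℂ, inner_app_app hM]

lemma conjTranspose_A_mul_A : Aᴴ * A = 1 := by
  ext i j
  fin_cases i <;> fin_cases j <;> simp [A, Matrix.mul_apply, Fin.sum_univ_three]

lemma A_pow_three : A ^ 3 = 1 := by
  ext i j
  fin_cases i <;> fin_cases j <;> simp [A, pow_succ, Matrix.mul_apply, Fin.sum_univ_three]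

lemma app_A_apply (v : E3) (i : Fin 3) : app A v i = v (i + 1) := by
  fin_cases i <;> simp [app, A, Matrix.toLpLin_apply, dotProduct, Fin.sum_univ_three]

open scoped Fin.CommRing in
lemma app_A_pow_apply (k : ℕ) (v : E3) (i : Fin 3) : app (A ^ k) v i = v (i + (k : Fin 3)) := by
  induction k generalizing i with
  | zero => simp [app_one]
  | succ k ih =>
    rw [pow_succ', app_mul, app_A_apply, ih]
    rw [Nat.cast_succ, add_assoc, add_comm 1]

lemma norm_app_A_pow (k : ℕ) (v : E3) : ‖app (A ^ k) v‖ = ‖v‖ := by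
  induction k with
  | zero => simp [app_one]
  | succ k ih => rw [pow_succ', app_mul, norm_app conjTranspose_A_mul_A, ih]

lemma norm_sq_eq_sum_three (v : E3) : ‖v‖ ^ 2 = ‖v 0‖ ^ 2 + ‖v 1‖ ^ 2 + ‖v 2‖ ^ 2 := by
  rw [EuclideanSpace.norm_sq_eq, Fin.sum_univ_three]

open scoped Fin.CommRing in
lemma mem_U1_iff (ε : ℝ) (w : S5) : w ∈ U1 ε ↔ ∃ i, 1 - ε ≤ ‖(w : E3) i‖ ^ 2 := by
  constructor
  · rintro ⟨k, v, hv, hvε, hw⟩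
    refine ⟨-(k : Fin 3), ?_⟩
    have := norm_sq_eq_sum_three v
    rw [hw, app_A_pow_apply, neg_add_cancel]
    rw [hv] at this
    linarith
  · rintro ⟨i, hi⟩
    have hwn : ‖(w : E3)‖ = 1 := by simp
    refine ⟨3 - i, app (A ^ (i : ℕ)) w, by rw [norm_app_A_pow, hwn], ?_, ?_⟩
    · have h := norm_sq_eq_sum_three (app (A ^ (i : ℕ)) w)
      rw [norm_app_A_pow, hwn, app_A_pow_apply _ _ 0, zero_add, Fin.cast_val_eq_self] at h
      linarith
    · rw [← app_mul, ← pow_add, Nat.sub_add_cancel i.isLt.le, A_pow_three, app_one]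

lemma U1_eq_iUnion_tube (ε : ℝ) :
    U1 ε = ⋃ i, tube (1 - ε) (EuclideanSpace.single i (1 : ℂ)) := by
  ext w
  simp [mem_U1_iff, tube, EuclideanSpace.inner_single_left]

lemma ξ_pow_three : ξ ^ 3 = 1 := by
  rw [ξ, ← Complex.exp_nat_mul]
  convert Complex.exp_two_pi_mul_I using 2
  push_cast; ring

lemma norm_ξ : ‖ξ‖ = 1 := by
  have h : ‖ξ‖ ^ 3 = 1 := by rw [← norm_pow, ξ_pow_three, norm_one]
  exact (pow_eq_one_iff_of_nonneg (norm_nonneg _) three_ne_zero).mp h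

lemma one_add_ξ_add_ξ_sq : 1 + ξ + ξ ^ 2 = 0 := by
  have hne : ξ ≠ 1 := (Complex.isPrimitiveRoot_exp 3 three_ne_zero).ne_one (by norm_num)
  have h : (ξ - 1) * (1 + ξ + ξ ^ 2) = 0 := by linear_combination ξ_pow_three
  exact (mul_eq_zero.mp h).resolve_left (sub_ne_zero.mpr hne)

lemma conj_ξ : starRingEnd ℂ ξ = ξ ^ 2 := by
  have h : ξ * starRingEnd ℂ ξ = 1 := by rw [Complex.mul_conj']; simp [norm_ξ]
  linear_combination ξ ^ 2 * h - starRingEnd ℂ ξ * ξ_pow_three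

lemma conjTranspose_P_mul_P : Pᴴ * P = 1 := by
  have hs : ((Real.sqrt 3 : ℝ) : ℂ)⁻¹ * ((Real.sqrt 3 : ℝ) : ℂ)⁻¹ = 1 / 3 := by
    rw [← mul_inv, ← Complex.ofReal_mul, Real.mul_self_sqrt (by norm_num)]; norm_num
  have hQ : (!![1, ξ, 1; 1, 1, ξ; ξ, 1, 1] : Matrix (Fin 3) (Fin 3) ℂ)ᴴ *
      !![1, ξ, 1; 1, 1, ξ; ξ, 1, 1] = (3 : ℂ) • 1 := by
    ext i j
    fin_cases i <;> fin_cases j <;>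
      simp [Matrix.mul_apply, Fin.sum_univ_three, conj_ξ] <;>
      first
      | linear_combination one_add_ξ_add_ξ_sq
      | linear_combination ξ_pow_three
  rw [P, conjTranspose_smul, smul_mul_smul_comm, hQ]
  simp only [star_inv₀, RCLike.star_def, Complex.conj_ofReal]
  rw [hs, smul_smul]
  norm_num

lemma U2_eq_iUnion_tube (ε : ℝ) :
    U2 ε = ⋃ i, tube (1 - ε) (app P (EuclideanSpace.single i (1 : ℂ))) := by
  ext w
  simp only [Set.mem_iUnion]
  constructor
  · rintro ⟨u, hu, hw⟩
    obtain ⟨i, hi⟩ := (mem_U1_iff ε u).mp hu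
    refine ⟨i, ?_⟩
    rw [tube, Set.mem_ofPred_eq, hw, inner_app_app conjTranspose_P_mul_P]
    simpa [EuclideanSpace.inner_single_left] using hi
  · rintro ⟨i, hi⟩
    have hP : P * Pᴴ = 1 := mul_eq_one_comm.mp conjTranspose_P_mul_P
    have hw : (w : E3) = app P (app Pᴴ w) := by rw [← app_mul, hP, app_one]
    have hwn : ‖(w : E3)‖ = 1 := by simp
    refine ⟨⟨app Pᴴ w, ?_⟩, (mem_U1_iff ε _).mpr ⟨i, ?_⟩, hw⟩
    · rw [mem_sphere_zero_iff_norm, norm_app (by rw [conjTranspose_conjTranspose, hP]), hwn]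
    · rw [tube, Set.mem_ofPred_eq, hw, inner_app_app conjTranspose_P_mul_P] at hi
      simpa [EuclideanSpace.inner_single_left] using hi

lemma norm_app_P_apply_le (u : E3) (i : Fin 3) :
    ‖app P u i‖ ≤ (Real.sqrt 3)⁻¹ * (‖u 0‖ + ‖u 1‖ + ‖u 2‖) := by
  have hentry : ∀ j, ‖P i j‖ = (Real.sqrt 3)⁻¹ := by
    intro j
    fin_cases i <;> fin_cases j <;> simp [P, norm_ξ, abs_of_nonneg (Real.sqrt_nonneg 3)]
  have h : app P u i = P i 0 * u 0 + P i 1 * u 1 + P i 2 * u 2 := by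
    simp [app, Matrix.toLpLin_apply, Matrix.mulVec, dotProduct, Fin.sum_univ_three]
  rw [h]
  refine norm_add₃_le.trans ?_
  rw [norm_mul, norm_mul, norm_mul, hentry, hentry, hentry]
  exact le_of_eq (by ring)

lemma disjoint_U1_U2 {ε : ℝ} (hε : ε ≤ 1 / 8) : Disjoint (U1 ε) (U2 ε) := by
  rw [Set.disjoint_left]
  rintro w hw ⟨u, hu, hwu⟩
  obtain ⟨i, hi⟩ := (mem_U1_iff ε w).mp hw
  obtain ⟨j, hj⟩ := (mem_U1_iff ε u).mp hu
  have hun : ‖(u : E3)‖ = 1 := by simp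
  have hsum := norm_sq_eq_sum_three (u : E3)
  rw [hun] at hsum
  have hle := pow_le_pow_left₀ (norm_nonneg _) (norm_app_P_apply_le u i) 2
  rw [← hwu, mul_pow, inv_pow, Real.sq_sqrt (by norm_num)] at hle
  have bound : ∀ a b c : ℝ, 7 / 8 ≤ a ^ 2 → 1 ^ 2 = a ^ 2 + b ^ 2 + c ^ 2 →
      (a + b + c) ^ 2 ≤ 9 / 4 := by
    intro a b c ha habc
    have hbc : |b + c| ≤ 1 / 2 := abs_le_of_sq_le_sq (by nlinarith [sq_nonneg (b - c)]) (by norm_num)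
    have ha1 : |a| ≤ 1 := abs_le_of_sq_le_sq (by nlinarith [sq_nonneg b, sq_nonneg c]) (by norm_num)
    have h := (abs_add_le a (b + c)).trans (add_le_add ha1 hbc)
    rw [← add_assoc] at h
    calc (a + b + c) ^ 2 = |a + b + c| ^ 2 := (sq_abs _).symm
      _ ≤ (1 + 1 / 2) ^ 2 := pow_le_pow_left₀ (abs_nonneg _) h 2
      _ = 9 / 4 := by norm_num
  have hb : (‖(u : E3) 0‖ + ‖(u : E3) 1‖ + ‖(u : E3) 2‖) ^ 2 ≤ 9 / 4 := by
    have hj' : 7 / 8 ≤ ‖(u : E3) j‖ ^ 2 := by linarith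
    rcases (by fin_cases j <;> simp : j = 0 ∨ j = 1 ∨ j = 2) with rfl | rfl | rfl
    · exact bound _ _ _ hj' hsum
    · linarith [bound _ ‖(u : E3) 0‖ ‖(u : E3) 2‖ hj' (by linarith)]
    · linarith [bound _ ‖(u : E3) 0‖ ‖(u : E3) 1‖ hj' (by linarith)]
  linarith

/-- The frontier (in `S⁵`) of `U₀` is the union of the frontiers of `U₁` and `U₂`. -/
theorem frontier_U0_eq_union (ε : ℝ) (hε0 : 0 < ε) (hε : ε ≤ 1 / 8) :
    frontier (U0 ε) = frontier (U1 ε) ∪ frontier (U2 ε) := by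
  have hc1 : IsClosed (U1 ε) := by
    rw [U1_eq_iUnion_tube]; exact isClosed_iUnion_of_finite fun i => isClosed_tube _ _
  have hc2 : IsClosed (U2 ε) := by
    rw [U2_eq_iUnion_tube]; exact isClosed_iUnion_of_finite fun i => isClosed_tube _ _
  have hreg : ∀ e : E3, ‖e‖ = 1 → tube (1 - ε) e ⊆ U1 ε ∪ U2 ε →
      tube (1 - ε) e ⊆ closure (interior (U1 ε ∪ U2 ε)) := fun e he hsub =>
    (tube_subset_closure_interior (by linarith) (by linarith) he).trans
      (closure_mono (interior_mono hsub))
  have hsingle : ∀ i : Fin 3, ‖EuclideanSpace.single i (1 : ℂ)‖ = 1 := fun i => by simp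
  rw [U0, (hc1.union hc2).frontier_closure_compl, hc1.frontier_union_of_disjoint hc2
    (disjoint_U1_U2 hε)]
  rintro w (hw | hw)
  · obtain ⟨i, hi⟩ := Set.mem_iUnion.mp (U1_eq_iUnion_tube ε ▸ hw)
    refine hreg _ (hsingle i) (Set.Subset.trans ?_ Set.subset_union_left) hi
    rw [U1_eq_iUnion_tube]
    exact Set.subset_iUnion_of_subset i subset_rfl
  · obtain ⟨i, hi⟩ := Set.mem_iUnion.mp (U2_eq_iUnion_tube ε ▸ hw)
    refine hreg _ ((norm_app conjTranspose_P_mul_P _).trans (hsingle i))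
      (Set.Subset.trans ?_ Set.subset_union_right) hi
    rw [U2_eq_iUnion_tube]
    exact Set.subset_iUnion_of_subset i subset_rfl
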